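/- Let A be the explicit 7×7 integer matrix given in the context. Then det(A) = −1, the characteristic polynomial of A is p(X) = X⁷ − 23X⁴ − 28X³ − 33X² − 17X + 1, and p(X) is irreducible over ℚ. -/

import Mathlib

open Polynomial

def Amat : Matrix (Fin 7) (Fin 7) ℤ :=
  !![0,0,1,1,3,0,0; 1,0,0,0,3,0,0; 0,1,0,0,3,0,0; 0,0,1,0,3,0,0;
     0,0,0,0,0,0,1; 1,1,1,1,10,0,0; 1,1,1,1,0,1,0]

/-- The characteristic polynomial `p(X) = X⁷ − 23X⁴ − 28X³ − 33X² − 17X + 1`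
of `A`, as an integer polynomial. -/
noncomputable def pA : Polynomial ℤ :=
  X ^ 7 - 23 * X ^ 4 - 28 * X ^ 3 - 33 * X ^ 2 - 17 * X + 1

theorem monic_pA : pA.Monic := by
  unfold pA; monicity!

theorem natDegree_pA : pA.natDegree = 7 := by
  unfold pA; compute_degree!

theorem coeff_pA (n : ℕ) : pA.coeff n = (if n = 7 then 1 else 0) - (if n = 4 then 23 else 0) -
    (if n = 3 then 28 else 0) - (if n = 2 then 33 else 0) - (if n = 1 then 17 else 0) +
    (if n = 0 then 1 else 0) := by
  simp only [pA, coeff_add, coeff_sub, coeff_ofNat_mul, coeff_X_pow, coeff_X, coeff_one,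
    eq_comm (a := 1) (b := n), mul_ite, mul_one, mul_zero]

instance fact_prime_five : Fact (Nat.Prime 5) := ⟨Nat.prime_five⟩

theorem irreducible_pA_map_zmod : Irreducible (pA.map (Int.castRingHom (ZMod 5))) := by
  have hm : (pA.map (Int.castRingHom (ZMod 5))).Monic := monic_pA.map _
  have hd : (pA.map (Int.castRingHom (ZMod 5))).natDegree = 7 := by
    rw [monic_pA.natDegree_map, natDegree_pA]
  have hone : pA.map (Int.castRingHom (ZMod 5)) ≠ 1 := by
    intro h
    simp [h] at hd
  rw [hm.irreducible_iff_lt_natDegree_lt hone, hd]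
  rintro q hq hqd ⟨r, hr⟩
  have hrm : r.Monic := hq.of_mul_monic_left (hr ▸ hm)
  have hdeg : q.natDegree + r.natDegree = 7 := by
    rw [← hq.natDegree_mul hrm, ← hr, hd]
  have hc (n : ℕ) := congrArg (fun p => p.coeff n) hr
  simp only [coeff_map, coeff_pA, coeff_mul,
    Finset.Nat.sum_antidiagonal_eq_sum_range_succ_mk] at hc
  have h0 := hc 0
  have h1 := hc 1
  have h2 := hc 2
  have h3 := hc 3
  have h4 := hc 4
  have h5 := hc 5
  have h6 := hc 6
  have hql : q.coeff q.natDegree = 1 := hq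
  have hrl : r.coeff r.natDegree = 1 := hrm
  have hqz (n : ℕ) (hn : q.natDegree < n) : q.coeff n = 0 := coeff_eq_zero_of_natDegree_lt hn
  have hrz (n : ℕ) (hn : r.natDegree < n) : r.coeff n = 0 := coeff_eq_zero_of_natDegree_lt hn
  obtain ⟨hpos, hle⟩ := Finset.mem_Ioc.mp hqd
  obtain hk | hk | hk : q.natDegree = 1 ∨ q.natDegree = 2 ∨ q.natDegree = 3 := by omega
  · have hl : r.natDegree = 6 := by omega
    rw [hk] at hql hqz
    rw [hl] at hrl
    simp [Finset.sum_range_succ, hql, hrl, hqz] at h0 h1 h2 h3 h4 h5 h6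
    have key : ∀ a : ZMod 5, 1 + 17 * a - 33 * a ^ 2 + 28 * a ^ 3 - 23 * a ^ 4 - a ^ 7 ≠ 0 := by
      decide +kernel
    apply key (q.coeff 0)
    linear_combination h0 - q.coeff 0 * h1 + q.coeff 0 ^ 2 * h2 - q.coeff 0 ^ 3 * h3 +
      q.coeff 0 ^ 4 * h4 - q.coeff 0 ^ 5 * h5 + q.coeff 0 ^ 6 * h6
  · have hl : r.natDegree = 5 := by omega
    rw [hk] at hql hqz
    rw [hl] at hrl hrz
    simp [Finset.sum_range_succ, hql, hrl, hqz, hrz] at h0 h1 h2 h3 h4 h5 h6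
    have key : ∀ a b e₄ : ZMod 5, 0 = b + e₄ → ∀ e₃, 0 = a + b * e₄ + e₃ →
        ∀ e₂, -23 = a * e₄ + b * e₃ + e₂ → ∀ e₁, -28 = a * e₃ + b * e₂ + e₁ →
        ∀ e₀, -33 = a * e₂ + b * e₁ + e₀ → -17 = a * e₁ + b * e₀ → 1 ≠ a * e₀ := by
      decide +kernel
    exact key _ _ _ h6 _ h5 _ h4 _ h3 _ h2 h1 h0
  · have hl : r.natDegree = 4 := by omega
    rw [hk] at hql hqz
    rw [hl] at hrl hrz
    simp [Finset.sum_range_succ, hql, hrl, hqz, hrz] at h0 h1 h2 h3 h4 h5 h6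
    have key : ∀ a b c e₃ : ZMod 5, 0 = c + e₃ → ∀ e₂, 0 = b + c * e₃ + e₂ →
        ∀ e₁, -23 = a + b * e₃ + c * e₂ + e₁ → ∀ e₀, -28 = a * e₃ + b * e₂ + c * e₁ + e₀ →
        -33 = a * e₂ + b * e₁ + c * e₀ → -17 = a * e₁ + b * e₀ → 1 ≠ a * e₀ := by
      decide +kernel
    exact key _ _ _ _ h6 _ h5 _ h4 _ h3 h2 h1 h0

theorem irreducible_pA_map_rat : Irreducible (pA.map (Int.castRingHom ℚ)) :=
  (monic_pA.irreducible_iff_irreducible_map_fraction_map (K := ℚ)).mp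
    (monic_pA.irreducible_of_irreducible_map (Int.castRingHom (ZMod 5)) _ irreducible_pA_map_zmod)

theorem aeval_Amat_pA : aeval Amat pA = 0 := by
  have h : Amat ^ 7 - 23 * Amat ^ 4 - 28 * Amat ^ 3 - 33 * Amat ^ 2 - 17 * Amat + 1 = 0 := by
    decide +kernel
  simpa [pA, map_ofNat (aeval Amat)] using h

theorem charpoly_Amat : Amat.charpoly = pA := by
  apply map_injective (Int.castRingHom ℚ) Int.cast_injective
  rw [← Matrix.charpoly_map]
  set B := Amat.map (Int.castRingHom ℚ)
  have hB : aeval B (pA.map (Int.castRingHom ℚ)) = 0 := by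
    have hB : B = (Int.castRingHom ℚ).toIntAlgHom.mapMatrix Amat := rfl
    rw [← algebraMap_int_eq, aeval_map_algebraMap, hB, aeval_algHom_apply, aeval_Amat_pA, map_zero]
  have hmin : pA.map (Int.castRingHom ℚ) = minpoly ℚ B :=
    minpoly.eq_of_irreducible_of_monic irreducible_pA_map_rat hB (monic_pA.map _)
  refine eq_of_monic_of_dvd_of_natDegree_le (monic_pA.map _) (Matrix.charpoly_monic B) ?_ ?_
  · rw [hmin]
    exact Matrix.minpoly_dvd_charpoly B
  · rw [Matrix.charpoly_natDegree_eq_dim, monic_pA.natDegree_map, natDegree_pA, Fintype.card_fin]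

/-- `det A = −1`, the characteristic polynomial of `A` is
`X⁷ − 23X⁴ − 28X³ − 33X² − 17X + 1`, and this polynomial is irreducible over `ℚ`. -/
theorem det_charpoly_irreducible :
    Amat.det = -1 ∧ Matrix.charpoly Amat = pA ∧
      Irreducible (pA.map (Int.castRingHom ℚ)) := by
  refine ⟨?_, charpoly_Amat, irreducible_pA_map_rat⟩
  rw [Matrix.det_eq_sign_charpoly_coeff, charpoly_Amat, coeff_pA]
  simp
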